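/- Let n ≥ 3. There is a constant C = C(n) such that for every Schwartz function f on ℝ^n, ∫_{ℝ^n} ⟨x⟩^{-2} ‖ t ↦ (e^{itΔ}f)(x) ‖²_{H^{1/4}(ℝ)} dx ≤ C ‖f‖²_{L²(ℝ^n)}. (For each fixed x, the function t ↦ (e^{itΔ}f)(x) belongs to L²(ℝ) since it decays like |t|^{-n/2}, so its H^{1/4}(ℝ) norm is defined; the time variable t ranges over all of ℝ, both positive and negative.) -/

import Mathlib

open MeasureTheory ENNReal SchwartzMap

/-- The free Schrödinger evolution `(e^{itΔ}f)(x)`, given for `t ≠ 0` by the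
explicit convolution formula with the principal branch of the complex power. -/
noncomputable def schrod (n : ℕ) (t : ℝ) (f : EuclideanSpace ℝ (Fin n) → ℂ)
    (x : EuclideanSpace ℝ (Fin n)) : ℂ :=
  if t = 0 then f x
  else (4 * Real.pi * Complex.I * (t : ℂ)) ^ (-(n : ℂ) / 2) *
    ∫ y : EuclideanSpace ℝ (Fin n),
      Complex.exp (Complex.I * (‖x - y‖ : ℂ) ^ 2 / (4 * (t : ℂ))) * f y

/-- The square of the `H^s(ℝ)` norm of `v : ℝ → ℂ`, defined via the Fourier
transform `v̂(λ) = ∫ e^{-itλ} v(t) dt`. -/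
noncomputable def HnormSq (s : ℝ) (v : ℝ → ℂ) : ℝ≥0∞ :=
  ∫⁻ lam : ℝ, ENNReal.ofReal ((1 + lam ^ 2) ^ s) *
    (‖∫ t : ℝ, Complex.exp (-(Complex.I * (t : ℂ) * (lam : ℂ))) * v t‖₊ : ℝ≥0∞) ^ 2

namespace FreeSmoothing

open scoped FourierTransform RealInnerProductSpace

section Polar

variable {V : Type*} [NormedAddCommGroup V] [InnerProductSpace ℝ V] [FiniteDimensional ℝ V]
  [MeasurableSpace V] [BorelSpace V]

/-- The surface measure on the unit sphere. -/
noncomputable abbrev surface (V : Type*) [NormedAddCommGroup V] [InnerProductSpace ℝ V]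
    [FiniteDimensional ℝ V] [MeasurableSpace V] [BorelSpace V] :
    Measure (Metric.sphere (0 : V) 1) :=
  (volume : Measure V).toSphere

/-- The radial measure `r ^ (d - 1) dr` on the positive half-line, as a measure on `ℝ`. -/
noncomputable def radial (d : ℕ) : Measure ℝ :=
  (volume.restrict (Set.Ioi 0)).withDensity fun r => ENNReal.ofReal (r ^ (d - 1))

lemma radial_eq_map (d : ℕ) :
    radial d = (Measure.volumeIoiPow (d - 1)).map Subtype.val := by
  ext s hs
  rw [Measure.map_apply measurable_subtype_coe hs, Measure.volumeIoiPow, radial,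
    withDensity_apply _ hs, withDensity_apply _ (measurable_subtype_coe hs),
    setLIntegral_subtype measurableSet_Ioi _ fun a : ℝ => ENNReal.ofReal (a ^ (d - 1)),
    Measure.restrict_restrict hs, Subtype.image_preimage_coe, Set.inter_comm]

instance (d : ℕ) : SFinite (radial d) := by
  unfold radial; infer_instance

lemma measurePreserving_polar [Nontrivial V] :
    MeasurePreserving (fun p : Metric.sphere (0 : V) 1 × ℝ => p.2 • (p.1 : V))
      ((surface V).prod (radial (Module.finrank ℝ V))) volume := by
  have hm : Measurable (fun p : Metric.sphere (0 : V) 1 × ℝ => p.2 • (p.1 : V)) := by fun_prop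
  refine ⟨hm, ?_⟩
  have h1 := (volume : Measure V).measurePreserving_homeomorphUnitSphereProd
  have h2 := h1.symm (homeomorphUnitSphereProd V).toMeasurableEquiv
  have h3 : (surface V).prod (radial (Module.finrank ℝ V)) =
      ((surface V).prod (Measure.volumeIoiPow (Module.finrank ℝ V - 1))).map
        (Prod.map id Subtype.val) := by
    rw [← Measure.map_prod_map _ _ measurable_id measurable_subtype_coe, Measure.map_id,
      radial_eq_map]
  rw [h3, Measure.map_map hm (measurable_id.prodMap measurable_subtype_coe)]
  have h4 : (fun p : Metric.sphere (0 : V) 1 × ℝ => p.2 • (p.1 : V)) ∘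
      (Prod.map id Subtype.val) = Subtype.val ∘ (homeomorphUnitSphereProd V).symm := by
    ext p; simp
  rw [h4, ← Measure.map_map measurable_subtype_coe
    (homeomorphUnitSphereProd V).symm.measurable]
  have h5 := h2.map_eq
  rw [show ((homeomorphUnitSphereProd V).toMeasurableEquiv.symm :
    _ → ({0}ᶜ : Set V)) = (homeomorphUnitSphereProd V).symm from rfl] at h5
  rw [h5, map_comap_subtype_coe (measurableSet_singleton _).compl,
    restrict_compl_singleton]

lemma lintegral_radial (d : ℕ) {F : ℝ → ℝ≥0∞} (hF : Measurable F) :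
    ∫⁻ r, F r ∂(radial d) = ∫⁻ r in Set.Ioi 0, ENNReal.ofReal (r ^ (d - 1)) * F r := by
  rw [radial, lintegral_withDensity_eq_lintegral_mul _ (by fun_prop) hF]
  rfl

lemma integral_radial (d : ℕ) (F : ℝ → ℂ) :
    ∫ r, F r ∂(radial d) = ∫ r in Set.Ioi (0 : ℝ), (r ^ (d - 1) : ℝ) • F r := by
  rw [radial, integral_withDensity_eq_integral_toReal_smul (by fun_prop) (by simp)]
  refine setIntegral_congr_fun measurableSet_Ioi fun r hr => ?_
  simp only [ENNReal.toReal_ofReal (pow_nonneg (le_of_lt hr) _)]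

lemma integrable_radial_iff (d : ℕ) {F : ℝ → ℂ} :
    Integrable F (radial d) ↔ IntegrableOn (fun r => (r ^ (d - 1) : ℝ) • F r) (Set.Ioi 0) := by
  rw [radial, integrable_withDensity_iff_integrable_smul' (by fun_prop) (by simp)]
  refine integrable_congr ?_
  filter_upwards [ae_restrict_mem measurableSet_Ioi] with r hr
  simp only [ENNReal.toReal_ofReal (pow_nonneg (le_of_lt hr) _)]

lemma lintegral_polar [Nontrivial V] {F : V → ℝ≥0∞} (hF : Measurable F) :
    ∫⁻ x, F x = ∫⁻ r in Set.Ioi (0 : ℝ), ENNReal.ofReal (r ^ (Module.finrank ℝ V - 1)) *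
      ∫⁻ ω, F (r • (ω : V)) ∂(surface V) := by
  have hm : Measurable (fun p : Metric.sphere (0 : V) 1 × ℝ => F (p.2 • (p.1 : V))) :=
    hF.comp (by fun_prop)
  rw [← measurePreserving_polar.lintegral_comp hF, lintegral_prod_symm _ hm.aemeasurable,
    lintegral_radial _ hm.lintegral_prod_left']

end Polar

section Gaussian

open Real

variable {V : Type*} [NormedAddCommGroup V] [InnerProductSpace ℝ V] [FiniteDimensional ℝ V]
  [MeasurableSpace V] [BorelSpace V]

lemma integrable_gaussian {a : ℝ} (ha : 0 < a) :
    Integrable (fun y : V => rexp (-a * ‖y‖ ^ 2)) := by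
  by_contra h
  have h1 := GaussianFourier.integral_rexp_neg_mul_sq_norm (V := V) ha
  rw [integral_undef h] at h1
  exact (rpow_pos_of_pos (div_pos pi_pos ha) _).ne h1

lemma lintegral_gaussian {a : ℝ} (ha : 0 < a) :
    ∫⁻ y : V, ENNReal.ofReal (rexp (-a * ‖y‖ ^ 2)) =
      ENNReal.ofReal ((π / a) ^ (Module.finrank ℝ V / 2 : ℝ)) := by
  rw [← GaussianFourier.integral_rexp_neg_mul_sq_norm (V := V) ha,
    ofReal_integral_eq_lintegral_ofReal (integrable_gaussian ha) (.of_forall fun _ => by positivity)]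

lemma lintegral_surface_gaussian_le [Nontrivial V] {a : ℝ} (ha : 0 < a)
    (ω : Metric.sphere (0 : V) 1) :
    ∫⁻ ω', ENNReal.ofReal (rexp (-(2 * a) * ‖(ω : V) - ω'‖ ^ 2)) ∂(surface V) ≤
      ENNReal.ofReal (rexp 2 * (π / a) ^ (Module.finrank ℝ V / 2 : ℝ) * √a) := by
  set d := Module.finrank ℝ V
  set I := ∫⁻ ω', ENNReal.ofReal (rexp (-(2 * a) * ‖(ω : V) - ω'‖ ^ 2)) ∂(surface V)
  have hsa : 0 < √a := sqrt_pos.2 ha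
  set G : V → ℝ≥0∞ := fun y => ENNReal.ofReal (rexp 2) * ENNReal.ofReal (rexp (-a * ‖(ω : V) - y‖ ^ 2))
  have hG : Measurable G := by fun_prop
  have hGint : ∫⁻ y, G y = ENNReal.ofReal (rexp 2 * (π / a) ^ (d / 2 : ℝ)) := by
    rw [lintegral_const_mul _ (by fun_prop),
      lintegral_sub_left_eq_self (fun y : V => ENNReal.ofReal (rexp (-a * ‖y‖ ^ 2))) (ω : V),
      lintegral_gaussian ha, ENNReal.ofReal_mul (by positivity)]
  have key : ∀ r ∈ Set.Ioc (1 : ℝ) (1 + 1 / √a), I ≤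
      ENNReal.ofReal (r ^ (d - 1)) * ∫⁻ ω', G (r • (ω' : V)) ∂(surface V) := by
    intro r hr
    have h1 : (1 : ℝ≥0∞) ≤ ENNReal.ofReal (r ^ (d - 1)) := by
      rw [ENNReal.one_le_ofReal]; exact one_le_pow₀ hr.1.le
    refine le_trans (lintegral_mono fun ω' => ?_) (le_mul_of_one_le_left (zero_le) h1)
    simp only [G]
    rw [← ENNReal.ofReal_mul (by positivity), ← Real.exp_add]
    refine ENNReal.ofReal_le_ofReal (exp_le_exp.2 ?_)
    have h2 : ‖(ω : V) - r • (ω' : V)‖ ≤ ‖(ω : V) - ω'‖ + 1 / √a := by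
      have : (ω : V) - r • (ω' : V) = ((ω : V) - ω') - (r - 1) • (ω' : V) := by
        rw [sub_smul, one_smul]; abel
      rw [this]
      refine (norm_sub_le _ _).trans ?_
      have h3 : ‖(ω' : V)‖ = 1 := by simp
      rw [norm_smul, h3, mul_one, Real.norm_of_nonneg (by linarith [hr.1])]
      linarith [hr.2]
    have h4 : a * (1 / √a) ^ 2 = 1 := by
      rw [div_pow, sq_sqrt ha.le]; field_simp
    have h5 : ‖(ω : V) - r • (ω' : V)‖ ^ 2 ≤ 2 * ‖(ω : V) - ω'‖ ^ 2 + 2 * (1 / √a) ^ 2 := by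
      have := pow_le_pow_left₀ (norm_nonneg _) h2 2
      nlinarith [sq_nonneg (‖(ω : V) - ω'‖ - 1 / √a)]
    nlinarith [mul_le_mul_of_nonneg_left h5 ha.le]
  have h6 : ENNReal.ofReal (1 / √a) * I ≤ ENNReal.ofReal (rexp 2 * (π / a) ^ (d / 2 : ℝ)) := by
    rw [← hGint, lintegral_polar hG]
    calc ENNReal.ofReal (1 / √a) * I = ∫⁻ r in Set.Ioc (1 : ℝ) (1 + 1 / √a), I := by
          rw [setLIntegral_const, Real.volume_Ioc, mul_comm]; simp
      _ ≤ ∫⁻ r in Set.Ioc (1 : ℝ) (1 + 1 / √a),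
          ENNReal.ofReal (r ^ (d - 1)) * ∫⁻ ω', G (r • (ω' : V)) ∂(surface V) :=
        setLIntegral_mono' measurableSet_Ioc key
      _ ≤ _ := lintegral_mono_set fun r hr => lt_trans one_pos hr.1
  calc I = ENNReal.ofReal (√a) * (ENNReal.ofReal (1 / √a) * I) := by
        rw [← mul_assoc, ← ENNReal.ofReal_mul hsa.le, mul_one_div_cancel hsa.ne',
          ENNReal.ofReal_one, one_mul]
    _ ≤ ENNReal.ofReal (√a) * ENNReal.ofReal (rexp 2 * (π / a) ^ (d / 2 : ℝ)) := by gcongr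
    _ = _ := by rw [← ENNReal.ofReal_mul hsa.le, mul_comm]

lemma enorm_mul_le_half_add {z w : ℂ} : ‖z‖ₑ * ‖w‖ₑ ≤ 2⁻¹ * ‖z‖ₑ ^ 2 + 2⁻¹ * ‖w‖ₑ ^ 2 := by
  have h : ‖z‖₊ * ‖w‖₊ ≤ 2⁻¹ * ‖z‖₊ ^ 2 + 2⁻¹ * ‖w‖₊ ^ 2 := by
    rw [← NNReal.coe_le_coe]
    push_cast
    nlinarith [sq_nonneg (‖z‖ - ‖w‖)]
  have := ENNReal.coe_le_coe.2 h
  push_cast at this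
  simpa [enorm_eq_nnnorm] using this

/-- Gaussian-weighted `L²` bound for the Fourier extension of a density `g` carried by
`p : X → V`, by the Schur test. -/
lemma lintegral_gaussian_mul_extension_le {X : Type*} [MeasurableSpace X] (μ : Measure X)
    [IsFiniteMeasure μ] {p : X → V} (hp : Measurable p) {g : X → ℂ} (hg : Measurable g) {M : ℝ}
    (hM : ∀ ω, ‖g ω‖ ≤ M) {s : ℝ} (hs : 0 < s) {K : ℝ≥0∞}
    (hK : ∀ ω, ∫⁻ ω', ENNReal.ofReal (rexp (-(π ^ 2 / s) * ‖p ω - p ω'‖ ^ 2)) ∂μ ≤ K) :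
    ∫⁻ x : V, ENNReal.ofReal (rexp (-s * ‖x‖ ^ 2)) *
      ‖∫ ω, Complex.exp (2 * π * Complex.I * ⟪x, p ω⟫) * g ω ∂μ‖ₑ ^ 2 ≤
    ENNReal.ofReal ((π / s) ^ (Module.finrank ℝ V / 2 : ℝ)) * (K * ∫⁻ ω, ‖g ω‖ₑ ^ 2 ∂μ) := by
  set e : V → X → ℂ := fun x ω => Complex.exp (2 * π * Complex.I * ⟪x, p ω⟫) * g ω with he
  have hem : Measurable (Function.uncurry e) := by
    simp only [he, Function.uncurry_def]
    fun_prop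
  have hen : ∀ x ω, ‖e x ω‖ = ‖g ω‖ := by
    intro x ω
    have : (2 * π * Complex.I * ⟪x, p ω⟫ : ℂ) = ((2 * π * ⟪x, p ω⟫ : ℝ) : ℂ) * Complex.I := by
      push_cast; ring
    simp only [he, norm_mul, this, Complex.norm_exp_ofReal_mul_I, one_mul]
  set ψ : V → X × X → ℂ := fun x q =>
    (rexp (-s * ‖x‖ ^ 2) : ℂ) * (e x q.1 * (starRingEnd ℂ) (e x q.2)) with hψ
  have hψm : Measurable (Function.uncurry ψ) := by
    have h1 : Measurable fun z : V × X × X => e z.1 z.2.1 :=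
      hem.comp (measurable_fst.prodMk (measurable_fst.comp measurable_snd))
    have h2 : Measurable fun z : V × X × X => e z.1 z.2.2 :=
      hem.comp (measurable_fst.prodMk (measurable_snd.comp measurable_snd))
    simp only [hψ, Function.uncurry_def]
    exact Measurable.mul (by fun_prop)
      (h1.mul ((Complex.continuous_conj.measurable).comp h2))
  have hψn : ∀ x q, ‖ψ x q‖ = rexp (-s * ‖x‖ ^ 2) * (‖g q.1‖ * ‖g q.2‖) := by
    intro x q
    simp only [hψ, norm_mul, RCLike.norm_conj, hen, Complex.norm_real, Real.norm_eq_abs,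
      abs_of_pos (Real.exp_pos _)]
  have hψi : Integrable (Function.uncurry ψ) (volume.prod (μ.prod μ)) := by
    have h1 : Integrable (fun z : V × X × X => rexp (-s * ‖z.1‖ ^ 2) * (M * M))
        (volume.prod (μ.prod μ)) :=
      (integrable_gaussian hs).mul_prod (integrable_const (M * M))
    refine h1.mono' hψm.aestronglyMeasurable (.of_forall fun z => ?_)
    rw [Function.uncurry_def]
    simp only [hψn]
    have hM0 : 0 ≤ M := (norm_nonneg _).trans (hM z.2.1)
    exact mul_le_mul_of_nonneg_left (mul_le_mul (hM _) (hM _) (norm_nonneg _) hM0)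
      (Real.exp_pos _).le
  have hinner : ∀ x, ∫ q, ψ x q ∂(μ.prod μ) =
      ((rexp (-s * ‖x‖ ^ 2) * ‖∫ ω, e x ω ∂μ‖ ^ 2 : ℝ) : ℂ) := by
    intro x
    simp only [hψ]
    rw [integral_const_mul, integral_prod_mul (e x) (fun ω => (starRingEnd ℂ) (e x ω)),
      integral_conj, Complex.mul_conj, Complex.normSq_eq_norm_sq]
    push_cast
    rfl
  have hpos : ∀ x, 0 ≤ rexp (-s * ‖x‖ ^ 2) * ‖∫ ω, e x ω ∂μ‖ ^ 2 := fun x => by positivity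
  have hri : Integrable (fun x : V => rexp (-s * ‖x‖ ^ 2) * ‖∫ ω, e x ω ∂μ‖ ^ 2) := by
    have := hψi.integral_prod_left.re
    simp only [Function.uncurry_apply_pair, hinner] at this
    exact this
  have hlhs : ∫⁻ x : V, ENNReal.ofReal (rexp (-s * ‖x‖ ^ 2)) * ‖∫ ω, e x ω ∂μ‖ₑ ^ 2 =
      ‖∫ x, ∫ q, ψ x q ∂(μ.prod μ)‖ₑ := by
    simp only [hinner]
    rw [integral_complex_ofReal, ← ofReal_norm, Complex.norm_real,
      Real.norm_of_nonneg (integral_nonneg hpos),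
      ofReal_integral_eq_lintegral_ofReal hri (.of_forall hpos)]
    refine lintegral_congr fun x => ?_
    rw [ENNReal.ofReal_mul (by positivity), ENNReal.ofReal_pow (norm_nonneg _), ofReal_norm]
  set k : X × X → ℝ≥0∞ := fun q =>
    ENNReal.ofReal (rexp (-(π ^ 2 / s) * ‖p q.1 - p q.2‖ ^ 2)) with hk
  have hkm : Measurable k := by
    simp only [hk]
    fun_prop
  have hswap : ∀ q, ‖∫ x, ψ x q‖ₑ =
      ENNReal.ofReal ((π / s) ^ (Module.finrank ℝ V / 2 : ℝ)) *
        (k q * (‖g q.1‖ₑ * ‖g q.2‖ₑ)) := by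
    intro q
    have h1 : ∀ x, ψ x q = Complex.exp (-(s : ℂ) * ‖x‖ ^ 2 +
        (2 * π * Complex.I) * ⟪p q.1 - p q.2, x⟫) * (g q.1 * (starRingEnd ℂ) (g q.2)) := by
      intro x
      simp only [hψ, he, map_mul, ← Complex.exp_conj, Complex.conj_I, Complex.conj_ofReal,
        map_ofNat, Complex.ofReal_exp]
      rw [inner_sub_left, real_inner_comm x (p q.1), real_inner_comm x (p q.2)]
      rw [show ∀ a b c u v : ℂ, a * (b * u * (c * v)) = a * b * c * (u * v) by intros; ring,
        ← Complex.exp_add, ← Complex.exp_add]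
      congr 2
      push_cast
      ring
    simp only [h1]
    rw [integral_mul_const, GaussianFourier.integral_cexp_neg_mul_sq_norm_add (by simpa using hs)]
    rw [enorm_mul, enorm_mul, enorm_mul, RCLike.enorm_conj, mul_assoc]
    have h2 : ((π : ℂ) / s) ^ (Module.finrank ℝ V / 2 : ℂ) =
        (((π / s) ^ (Module.finrank ℝ V / 2 : ℝ) : ℝ) : ℂ) := by
      rw [Complex.ofReal_cpow (by positivity)]
      push_cast
      rfl
    have h3 : Complex.exp ((2 * π * Complex.I) ^ 2 * ‖p q.1 - p q.2‖ ^ 2 / (4 * s)) =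
        ((rexp (-(π ^ 2 / s) * ‖p q.1 - p q.2‖ ^ 2) : ℝ) : ℂ) := by
      push_cast
      congr 1
      have : (s : ℂ) ≠ 0 := by exact_mod_cast hs.ne'
      rw [mul_pow, Complex.I_sq]
      field_simp
      ring
    rw [h2, h3, ← ofReal_norm (_ : ℂ), ← ofReal_norm ((rexp _ : ℝ) : ℂ), Complex.norm_real,
      Complex.norm_real, Real.norm_of_nonneg (by positivity), Real.norm_of_nonneg (by positivity)]
  rw [hlhs, integral_integral_swap hψi]
  refine (enorm_integral_le_lintegral_enorm _).trans ?_
  simp only [hswap]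
  have hgm : Measurable fun ω => ‖g ω‖ₑ ^ 2 := by fun_prop
  rw [lintegral_const_mul _ (by fun_prop)]
  gcongr
  have hA : ∫⁻ q, k q * (2⁻¹ * ‖g q.1‖ₑ ^ 2) ∂(μ.prod μ) ≤ 2⁻¹ * (K * ∫⁻ ω, ‖g ω‖ₑ ^ 2 ∂μ) := by
    rw [lintegral_prod _ (by fun_prop), ← mul_assoc, mul_comm 2⁻¹ K, mul_assoc,
      ← lintegral_const_mul _ hgm, ← lintegral_const_mul _ (by fun_prop)]
    refine lintegral_mono fun ω => ?_
    dsimp only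
    rw [lintegral_mul_const _ (by fun_prop)]
    gcongr
    exact hK ω
  have hB : ∫⁻ q, k q * (2⁻¹ * ‖g q.2‖ₑ ^ 2) ∂(μ.prod μ) ≤ 2⁻¹ * (K * ∫⁻ ω, ‖g ω‖ₑ ^ 2 ∂μ) := by
    rw [lintegral_prod_symm _ (by fun_prop), ← mul_assoc, mul_comm 2⁻¹ K, mul_assoc,
      ← lintegral_const_mul _ hgm, ← lintegral_const_mul _ (by fun_prop)]
    refine lintegral_mono fun ω => ?_
    dsimp only
    rw [lintegral_mul_const _ (by fun_prop)]
    gcongr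
    refine le_trans (le_of_eq (lintegral_congr fun ω' => ?_)) (hK ω)
    simp only [hk, norm_sub_rev]
  calc ∫⁻ q, k q * (‖g q.1‖ₑ * ‖g q.2‖ₑ) ∂(μ.prod μ)
      ≤ ∫⁻ q, (k q * (2⁻¹ * ‖g q.1‖ₑ ^ 2) + k q * (2⁻¹ * ‖g q.2‖ₑ ^ 2)) ∂(μ.prod μ) := by
        refine lintegral_mono fun q => ?_
        rw [← mul_add]
        gcongr
        exact enorm_mul_le_half_add
    _ ≤ 2⁻¹ * (K * ∫⁻ ω, ‖g ω‖ₑ ^ 2 ∂μ) + 2⁻¹ * (K * ∫⁻ ω, ‖g ω‖ₑ ^ 2 ∂μ) := by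
        rw [lintegral_add_left (by fun_prop)]
        exact add_le_add hA hB
    _ = _ := by rw [← add_mul, ENNReal.inv_two_add_inv_two, one_mul]

end Gaussian

section Weight

open Real

lemma lintegral_exp_neg_mul_Ioi {b : ℝ} (hb : 0 < b) :
    ∫⁻ s in Set.Ioi (0 : ℝ), ENNReal.ofReal (rexp (-b * s)) = ENNReal.ofReal b⁻¹ := by
  rw [← ofReal_integral_eq_lintegral_ofReal (exp_neg_integrableOn_Ioi 0 hb)
    (.of_forall fun _ => by positivity), integral_exp_mul_Ioi (by linarith)]
  congr 1
  simp [neg_div, div_neg]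

lemma setLIntegral_Ioc_rpow_neg_half {R : ℝ} (hR : 0 < R) :
    ∫⁻ s in Set.Ioc 0 R, ENNReal.ofReal (s ^ (-1 / 2 : ℝ)) = ENNReal.ofReal (2 * √R) := by
  have h := intervalIntegral.intervalIntegrable_rpow' (a := 0) (b := R)
    (r := (-1 / 2 : ℝ)) (by norm_num)
  rw [intervalIntegrable_iff_integrableOn_Ioc_of_le hR.le] at h
  rw [← ofReal_integral_eq_lintegral_ofReal h, ← intervalIntegral.integral_of_le hR.le,
    integral_rpow (Or.inl (by norm_num))]
  · congr 1
    norm_num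
    rw [sqrt_eq_rpow, mul_comm]
    ring
  · filter_upwards [ae_restrict_mem measurableSet_Ioc] with s hs
    exact rpow_nonneg hs.1.le _

lemma setLIntegral_Ioi_rpow {p R : ℝ} (hp : p < -1) (hR : 0 < R) :
    ∫⁻ s in Set.Ioi R, ENNReal.ofReal (s ^ p) = ENNReal.ofReal (-R ^ (p + 1) / (p + 1)) := by
  rw [← integral_Ioi_rpow_of_lt hp hR, ofReal_integral_eq_lintegral_ofReal
    (integrableOn_Ioi_rpow_of_lt hp hR)]
  filter_upwards [ae_restrict_mem measurableSet_Ioi] with s hs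
  exact rpow_nonneg (hR.trans hs).le _

lemma exists_lintegral_exp_mul_le {d : ℕ} (hd : 3 ≤ d) {A B : ℝ} (hA : 0 ≤ A) (hB : 0 ≤ B) :
    ∃ C : ℝ, 0 ≤ C ∧ ∀ r : ℝ, 0 < r → ∀ Φ : ℝ → ℝ≥0∞,
      (∀ s, 0 < s → Φ s ≤ ENNReal.ofReal (A * s ^ (-(d : ℝ) / 2))) →
      (∀ s, 0 < s → Φ s ≤ ENNReal.ofReal (B * (r / r ^ d) * s ^ (-1 / 2 : ℝ))) →
      ∫⁻ s in Set.Ioi (0 : ℝ), ENNReal.ofReal (rexp (-s)) * Φ s ≤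
        ENNReal.ofReal (C * (r ^ 2 / r ^ d) / (1 + r)) := by
  set c := ∫ s in Set.Ioi (0 : ℝ), rexp (-s) * s ^ ((1 / 2 : ℝ) - 1) with hc
  have hc0 : 0 ≤ c := setIntegral_nonneg measurableSet_Ioi fun s hs =>
    mul_nonneg (Real.exp_pos _).le (rpow_nonneg (le_of_lt hs) _)
  have hcl : ∫⁻ s in Set.Ioi (0 : ℝ), ENNReal.ofReal (rexp (-s) * s ^ (-1 / 2 : ℝ)) =
      ENNReal.ofReal c := by
    have h := Real.GammaIntegral_convergent (s := 1 / 2) (by norm_num)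
    rw [hc, ofReal_integral_eq_lintegral_ofReal h]
    · norm_num
    · filter_upwards [ae_restrict_mem measurableSet_Ioi] with s hs
      exact mul_nonneg (Real.exp_pos _).le (rpow_nonneg (le_of_lt hs) _)
  refine ⟨2 * (B * c + 2 * B + 2 * A), by positivity, fun r hr Φ h1 h2 => ?_⟩
  have hd' : (3 : ℝ) ≤ d := by exact_mod_cast hd
  have hrd : 0 < r ^ d := pow_pos hr d
  have bound1 : ∫⁻ s in Set.Ioi (0 : ℝ), ENNReal.ofReal (rexp (-s)) * Φ s ≤
      ENNReal.ofReal (B * (r / r ^ d) * c) := by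
    calc _ ≤ ∫⁻ s in Set.Ioi (0 : ℝ), ENNReal.ofReal (B * (r / r ^ d)) *
          ENNReal.ofReal (rexp (-s) * s ^ (-1 / 2 : ℝ)) := by
          refine setLIntegral_mono' measurableSet_Ioi fun s hs => ?_
          refine (mul_le_mul_right (h2 s hs) _).trans (le_of_eq ?_)
          rw [← ENNReal.ofReal_mul (by positivity), ← ENNReal.ofReal_mul (by positivity)]
          congr 1
          ring
      _ = _ := by
          rw [lintegral_const_mul _ (by fun_prop), hcl, ← ENNReal.ofReal_mul (by positivity)]
  have hle : ∀ s : ℝ, 0 < s → ENNReal.ofReal (rexp (-s)) * Φ s ≤ Φ s := fun s hs =>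
    mul_le_of_le_one_left (zero_le) (by
      rw [ENNReal.ofReal_le_one, Real.exp_le_one_iff]; linarith)
  have bound2 : ∫⁻ s in Set.Ioi (0 : ℝ), ENNReal.ofReal (rexp (-s)) * Φ s ≤
      ENNReal.ofReal ((2 * B + 2 * A) * (r ^ 2 / r ^ d)) := by
    rw [← Set.Ioc_union_Ioi_eq_Ioi (show (0 : ℝ) ≤ r ^ 2 by positivity),
      lintegral_union measurableSet_Ioi (Set.Ioc_disjoint_Ioi le_rfl), add_mul,
      ENNReal.ofReal_add (by positivity) (by positivity)]
    refine add_le_add ?_ ?_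
    · calc _ ≤ ∫⁻ s in Set.Ioc (0 : ℝ) (r ^ 2), ENNReal.ofReal (B * (r / r ^ d)) *
            ENNReal.ofReal (s ^ (-1 / 2 : ℝ)) := by
            refine setLIntegral_mono' measurableSet_Ioc fun s hs => ?_
            rw [← ENNReal.ofReal_mul (by positivity)]
            exact (hle s hs.1).trans (h2 s hs.1)
        _ = _ := by
            rw [lintegral_const_mul _ (by fun_prop), setLIntegral_Ioc_rpow_neg_half (by positivity),
              ← ENNReal.ofReal_mul (by positivity), sqrt_sq hr.le]
            congr 1
            ring
    · calc _ ≤ ∫⁻ s in Set.Ioi (r ^ 2), ENNReal.ofReal A *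
            ENNReal.ofReal (s ^ (-(d : ℝ) / 2)) := by
            refine setLIntegral_mono' measurableSet_Ioi fun s hs => ?_
            have hs0 : 0 < s := lt_trans (by positivity) hs
            rw [← ENNReal.ofReal_mul hA]
            exact (hle s hs0).trans (h1 s hs0)
        _ ≤ _ := by
            rw [lintegral_const_mul _ (by fun_prop),
              setLIntegral_Ioi_rpow (by linarith) (by positivity), ← ENNReal.ofReal_mul hA]
            refine ENNReal.ofReal_le_ofReal ?_
            have h3 : (r ^ 2) ^ (-(d : ℝ) / 2 + 1) = r ^ 2 / r ^ d := by
              rw [← Real.rpow_natCast, ← Real.rpow_natCast, ← rpow_mul hr.le, ← rpow_sub hr]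
              congr 1
              push_cast
              ring
            have h4 : -(r ^ 2 / r ^ d) / (-(d : ℝ) / 2 + 1) ≤ 2 * (r ^ 2 / r ^ d) := by
              rw [div_le_iff_of_neg (by linarith)]
              have : 0 < r ^ 2 / r ^ d := by positivity
              nlinarith
            rw [h3]
            nlinarith [mul_le_mul_of_nonneg_left h4 hA]
  have hQ : 0 < r ^ 2 / r ^ d := by positivity
  rcases le_total r 1 with h | h
  · refine bound2.trans (ENNReal.ofReal_le_ofReal ?_)
    rw [le_div_iff₀ (by positivity)]
    have h5 : 0 ≤ (2 * B + 2 * A) * (r ^ 2 / r ^ d) := by positivity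
    have h6 : 0 ≤ B * c * (r ^ 2 / r ^ d) := by positivity
    nlinarith
  · refine bound1.trans (ENNReal.ofReal_le_ofReal ?_)
    rw [le_div_iff₀ (by positivity)]
    have h5 : 0 ≤ (2 * B + 2 * A) * (r ^ 2 / r ^ d) := by positivity
    have h6 : r / r ^ d * (1 + r) ≤ 2 * (r ^ 2 / r ^ d) := by
      rw [div_mul_eq_mul_div, ← mul_div_assoc]
      exact div_le_div_of_nonneg_right (by nlinarith) hrd.le
    have h7 := mul_le_mul_of_nonneg_left h6 (mul_nonneg hB hc0)
    nlinarith

end Weight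

section Extension

open Real

variable {V : Type*} [NormedAddCommGroup V] [InnerProductSpace ℝ V] [FiniteDimensional ℝ V]
  [MeasurableSpace V] [BorelSpace V]

/-- Weighted `L²` bound for the Fourier extension operator of the sphere of radius `r`. -/
lemma exists_lintegral_weight_mul_extension_le (hd : 3 ≤ Module.finrank ℝ V) :
    ∃ C : ℝ, 0 ≤ C ∧ ∀ r : ℝ, 0 < r → ∀ (g : Metric.sphere (0 : V) 1 → ℂ) (M : ℝ),
      Measurable g → (∀ ω, ‖g ω‖ ≤ M) →
      ∫⁻ x : V, ENNReal.ofReal ((1 + ‖x‖ ^ 2)⁻¹) *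
        ‖∫ ω, Complex.exp (2 * π * Complex.I * ⟪x, r • (ω : V)⟫) * g ω ∂(surface V)‖ₑ ^ 2 ≤
      ENNReal.ofReal (C * (r ^ 2 / r ^ Module.finrank ℝ V) / (1 + r)) *
        ∫⁻ ω, ‖g ω‖ₑ ^ 2 ∂(surface V) := by
  set d := Module.finrank ℝ V
  have : Nontrivial V := Module.nontrivial_of_finrank_pos (R := ℝ) (by omega)
  set S := (surface V).real Set.univ
  obtain ⟨C, hC0, hC⟩ := exists_lintegral_exp_mul_le hd (A := π ^ (d / 2 : ℝ) * S)
    (B := rexp 2 * 2 ^ (d / 2 : ℝ) * (π * 2 ^ (-1 / 2 : ℝ))) (by positivity) (by positivity)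
  refine ⟨C, hC0, fun r hr g M hg hM => ?_⟩
  set E : V → ℂ := fun x =>
    ∫ ω, Complex.exp (2 * π * Complex.I * ⟪x, r • (ω : V)⟫) * g ω ∂(surface V) with hE
  have hEm : Measurable E := by
    refine StronglyMeasurable.measurable ?_
    refine StronglyMeasurable.integral_prod_right
      (f := fun x (ω : Metric.sphere (0 : V) 1) =>
        Complex.exp (2 * π * Complex.I * ⟪x, r • (ω : V)⟫) * g ω) ?_
    refine Measurable.stronglyMeasurable ?_
    simp only [Function.uncurry_def]
    fun_prop
  set N := ∫⁻ ω, ‖g ω‖ₑ ^ 2 ∂(surface V)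
  set a : ℝ → ℝ := fun s => π ^ 2 * r ^ 2 / (2 * s) with ha
  set K : ℝ → ℝ≥0∞ := fun s => min ((surface V) Set.univ)
    (ENNReal.ofReal (rexp 2 * (π / a s) ^ (d / 2 : ℝ) * √(a s))) with hK
  set Φ : ℝ → ℝ≥0∞ := fun s => ENNReal.ofReal ((π / s) ^ (d / 2 : ℝ)) * K s with hΦ
  have hΦm : Measurable Φ := by
    simp only [hΦ, hK, ha]
    fun_prop
  have hsch : ∀ s, 0 < s → ∫⁻ x : V, ENNReal.ofReal (rexp (-s * ‖x‖ ^ 2)) * ‖E x‖ₑ ^ 2 ≤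
      Φ s * N := by
    intro s hs
    have has : 0 < a s := by simp only [ha]; positivity
    rw [hΦ, mul_assoc]
    refine lintegral_gaussian_mul_extension_le (surface V)
      (p := fun ω : Metric.sphere (0 : V) 1 => r • (ω : V)) (by fun_prop) hg hM hs fun ω => ?_
    refine le_min ?_ ?_
    · calc _ ≤ ∫⁻ _, 1 ∂(surface V) := by
            refine lintegral_mono fun ω' => ?_
            rw [ENNReal.ofReal_le_one, Real.exp_le_one_iff, neg_mul, neg_nonpos]
            positivity
        _ = _ := by simp
    · refine le_trans (le_of_eq (lintegral_congr fun ω' => ?_))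
        (lintegral_surface_gaussian_le has ω)
      rw [← smul_sub, norm_smul, Real.norm_of_nonneg hr.le, mul_pow]
      congr 2
      simp only [ha]
      field_simp
  have hsub : ∀ x : V, ENNReal.ofReal ((1 + ‖x‖ ^ 2)⁻¹) * ‖E x‖ₑ ^ 2 =
      ∫⁻ s in Set.Ioi (0 : ℝ), ENNReal.ofReal (rexp (-s)) *
        (ENNReal.ofReal (rexp (-s * ‖x‖ ^ 2)) * ‖E x‖ₑ ^ 2) := by
    intro x
    rw [← lintegral_exp_neg_mul_Ioi (by positivity : 0 < 1 + ‖x‖ ^ 2),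
      ← lintegral_mul_const _ (by fun_prop)]
    refine lintegral_congr fun s => ?_
    rw [← mul_assoc, ← ENNReal.ofReal_mul (by positivity), ← Real.exp_add]
    ring_nf
  change ∫⁻ x : V, ENNReal.ofReal ((1 + ‖x‖ ^ 2)⁻¹) * ‖E x‖ₑ ^ 2 ≤ _
  simp only [hsub]
  rw [lintegral_lintegral_swap (by
    refine Measurable.aemeasurable ?_
    simp only [Function.uncurry_def]
    fun_prop)]
  calc _ ≤ ∫⁻ s in Set.Ioi (0 : ℝ), ENNReal.ofReal (rexp (-s)) * Φ s * N := by
        refine setLIntegral_mono' measurableSet_Ioi fun s hs => ?_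
        rw [lintegral_const_mul _ (by fun_prop), mul_assoc]
        gcongr
        exact hsch s hs
    _ = (∫⁻ s in Set.Ioi (0 : ℝ), ENNReal.ofReal (rexp (-s)) * Φ s) * N := by
        rw [lintegral_mul_const _ (by fun_prop)]
    _ ≤ _ := by
        gcongr
        refine hC r hr Φ (fun s hs => ?_) (fun s hs => ?_)
        · calc Φ s ≤ ENNReal.ofReal ((π / s) ^ (d / 2 : ℝ)) * (surface V) Set.univ := by
                simp only [hΦ, hK]; gcongr; exact min_le_left _ _
            _ = ENNReal.ofReal ((π / s) ^ (d / 2 : ℝ)) * ENNReal.ofReal S := by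
                rw [ofReal_measureReal]
            _ = _ := by
                rw [← ENNReal.ofReal_mul (by positivity), div_rpow pi_pos.le hs.le, neg_div,
                  rpow_neg hs.le]
                congr 1
                ring
        · calc Φ s ≤ ENNReal.ofReal ((π / s) ^ (d / 2 : ℝ)) *
                ENNReal.ofReal (rexp 2 * (π / a s) ^ (d / 2 : ℝ) * √(a s)) := by
                simp only [hΦ, hK]; gcongr; exact min_le_right _ _
            _ = _ := by
                rw [← ENNReal.ofReal_mul (by positivity)]
                congr 1
                have h1 : (π / s) ^ (d / 2 : ℝ) * (π / a s) ^ (d / 2 : ℝ) =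
                    2 ^ (d / 2 : ℝ) * (r ^ d)⁻¹ := by
                  rw [← mul_rpow (by positivity) (by simp only [ha]; positivity)]
                  have : π / s * (π / a s) = 2 * (r ^ (2 : ℕ))⁻¹ := by
                    simp only [ha]
                    field_simp
                  rw [this, mul_rpow (by norm_num) (by positivity), inv_rpow (by positivity),
                    ← Real.rpow_natCast, ← Real.rpow_natCast, ← rpow_mul hr.le]
                  congr 3
                  push_cast
                  ring
                have h2 : √(a s) = π * r * (2 ^ (-1 / 2 : ℝ) * s ^ (-1 / 2 : ℝ)) := by
                  rw [← mul_rpow (by norm_num) hs.le, neg_div, rpow_neg (by positivity),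
                    ← sqrt_eq_rpow]
                  simp only [ha]
                  rw [sqrt_div (by positivity), ← mul_pow, sqrt_sq (by positivity), div_eq_mul_inv]
                calc _ = rexp 2 * ((π / s) ^ (d / 2 : ℝ) * (π / a s) ^ (d / 2 : ℝ)) * √(a s) := by
                      ring
                  _ = _ := by
                      rw [h1, h2]
                      ring

end Extension

section Propagator

open Real Filter Topology

variable {V : Type*} [NormedAddCommGroup V] [InnerProductSpace ℝ V] [FiniteDimensional ℝ V]
  [MeasurableSpace V] [BorelSpace V]

/-- The free evolution at time `t` as a Fourier integral of `F = 𝓕 f`. -/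
noncomputable def freeWave (F : 𝓢(V, ℂ)) (x : V) (t : ℝ) : ℂ :=
  ∫ ξ, Complex.exp (-(4 * π ^ 2 * (Complex.I * t)) * ‖ξ‖ ^ 2 + 2 * π * Complex.I * ⟪x, ξ⟫) * F ξ

omit [FiniteDimensional ℝ V] [MeasurableSpace V] [BorelSpace V] in
lemma norm_cexp_gaussian_le (z : ℂ) (hz : 0 ≤ z.re) (x ξ : V) :
    ‖Complex.exp (-(4 * π ^ 2 * z) * ‖ξ‖ ^ 2 + 2 * π * Complex.I * ⟪x, ξ⟫)‖ ≤ 1 := by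
  have h : (-(4 * π ^ 2 * z) * ‖ξ‖ ^ 2 + 2 * π * Complex.I * ⟪x, ξ⟫ : ℂ) =
      ((-(4 * π ^ 2 * ‖ξ‖ ^ 2) : ℝ) : ℂ) * z + ((2 * π * ⟪x, ξ⟫ : ℝ) : ℂ) * Complex.I := by
    push_cast; ring
  rw [Complex.norm_exp, Real.exp_le_one_iff, h, Complex.add_re, Complex.re_ofReal_mul,
    Complex.re_ofReal_mul, Complex.I_re, mul_zero, add_zero]
  have : 0 ≤ 4 * π ^ 2 * ‖ξ‖ ^ 2 := by positivity
  nlinarith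

omit [InnerProductSpace ℝ V] [FiniteDimensional ℝ V] [MeasurableSpace V] [BorelSpace V] in
lemma norm_cexp_kernel_le (z : ℂ) (hz : 0 ≤ z.re) (x y : V) :
    ‖Complex.exp (-‖x - y‖ ^ 2 / (4 * z))‖ ≤ 1 := by
  have h : (-‖x - y‖ ^ 2 / (4 * z) : ℂ) = ((-(‖x - y‖ ^ 2 / 4) : ℝ) : ℂ) * z⁻¹ := by
    push_cast
    rw [div_eq_mul_inv, mul_inv]
    ring
  rw [Complex.norm_exp, Real.exp_le_one_iff, h, Complex.re_ofReal_mul, Complex.inv_re]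
  have h1 : 0 ≤ z.re / Complex.normSq z := div_nonneg hz (Complex.normSq_nonneg z)
  have h2 : 0 ≤ ‖x - y‖ ^ 2 / 4 := by positivity
  nlinarith

lemma integral_fourier_mul_gaussian (f : 𝓢(V, ℂ)) (x : V) {z : ℂ} (hz : 0 < z.re) :
    ∫ ξ, Complex.exp (-(4 * π ^ 2 * z) * ‖ξ‖ ^ 2 + 2 * π * Complex.I * ⟪x, ξ⟫) * 𝓕 f ξ =
      (4 * π * z) ^ (-(Module.finrank ℝ V : ℂ) / 2) *
        ∫ y, Complex.exp (-‖x - y‖ ^ 2 / (4 * z)) * f y := by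
  have hz0 : z ≠ 0 := by rintro rfl; simp at hz
  have hb : 0 < (4 * π ^ 2 * z : ℂ).re := by
    rw [show (4 * π ^ 2 * z : ℂ) = ((4 * π ^ 2 : ℝ) : ℂ) * z by push_cast; ring,
      Complex.re_ofReal_mul]
    positivity
  have h := VectorFourier.integral_fourierIntegral_smul_eq_flip (L := innerₗ V)
    (μ := volume) (ν := volume) Real.continuous_fourierChar continuous_inner f.integrable
    (GaussianFourier.integrable_cexp_neg_mul_sq_norm_add hb (2 * π * Complex.I) x)
  rw [flip_innerₗ] at h
  have h' : ∫ ξ, 𝓕 (f : V → ℂ) ξ * Complex.exp (-(4 * π ^ 2 * z) * ‖ξ‖ ^ 2 +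
      2 * π * Complex.I * ⟪x, ξ⟫) = ∫ y, f y * 𝓕 (fun ξ : V =>
        Complex.exp (-(4 * π ^ 2 * z) * ‖ξ‖ ^ 2 + 2 * π * Complex.I * ⟪x, ξ⟫)) y := h
  simp only [mul_comm (Complex.exp _), SchwartzMap.fourier_coe]
  rw [h', ← integral_const_mul]
  refine integral_congr_ae (.of_forall fun y => ?_)
  dsimp only
  rw [fourier_gaussian_innerProductSpace' hb]
  have hpi : (π : ℂ) ≠ 0 := by exact_mod_cast pi_ne_zero
  have h1 : (π : ℂ) / (4 * π ^ 2 * z) = (4 * π * z)⁻¹ := by field_simp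
  have h2 : -(π : ℂ) ^ 2 * ‖x - y‖ ^ 2 / (4 * π ^ 2 * z) = -‖x - y‖ ^ 2 / (4 * z) := by
    field_simp
  have h3 : (4 * π * z : ℂ).arg ≠ π := by
    rw [show (4 * π * z : ℂ) = ((4 * π : ℝ) : ℂ) * z by push_cast; ring,
      Complex.arg_real_mul _ (by positivity)]
    intro h4
    rw [Complex.arg_eq_pi_iff] at h4
    linarith [h4.1]
  rw [h1, h2, Complex.inv_cpow _ _ h3, ← Complex.cpow_neg, neg_div]
  ring_nf

/-- The convolution formula for the free evolution agrees with its Fourier representation. -/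
lemma kernel_integral_eq_freeWave (f : 𝓢(V, ℂ)) (x : V) {t : ℝ} (ht : t ≠ 0) :
    (4 * π * Complex.I * (t : ℂ)) ^ (-(Module.finrank ℝ V : ℂ) / 2) *
      ∫ y, Complex.exp (Complex.I * (‖x - y‖ : ℂ) ^ 2 / (4 * (t : ℂ))) * f y =
    freeWave (𝓕 f) x t := by
  set z : ℝ → ℂ := fun ε => ε + Complex.I * t with hz
  have hzc : Continuous z := by fun_prop
  have hz0 : z 0 = Complex.I * t := by simp [hz]
  have hzre : ∀ ε, (z ε).re = ε := by simp [hz]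
  have hzim : ∀ ε, (z ε).im = t := by simp [hz]
  have hzne : ∀ ε, z ε ≠ 0 := fun ε h => ht (by rw [← hzim ε, h, Complex.zero_im])
  have hpos : ∀ᶠ ε : ℝ in 𝓝[>] 0, 0 < ε := self_mem_nhdsWithin
  have hl : Tendsto (fun ε => ∫ ξ, Complex.exp (-(4 * π ^ 2 * z ε) * ‖ξ‖ ^ 2 +
      2 * π * Complex.I * ⟪x, ξ⟫) * 𝓕 f ξ) (𝓝[>] 0) (𝓝 (freeWave (𝓕 f) x t)) := by
    rw [freeWave, ← hz0]
    refine tendsto_integral_filter_of_dominated_convergence (fun ξ => ‖𝓕 f ξ‖) ?_ ?_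
      (𝓕 f).integrable.norm ?_
    · exact .of_forall fun ε => Continuous.aestronglyMeasurable (by fun_prop)
    · filter_upwards [hpos] with ε hε
      refine .of_forall fun ξ => ?_
      rw [norm_mul]
      exact mul_le_of_le_one_left (norm_nonneg _)
        (norm_cexp_gaussian_le _ (by rw [hzre]; exact hε.le) _ _)
    · refine .of_forall fun ξ => ?_
      exact ((by fun_prop : Continuous fun ε => Complex.exp (-(4 * π ^ 2 * z ε) * ‖ξ‖ ^ 2 +
        2 * π * Complex.I * ⟪x, ξ⟫) * 𝓕 f ξ).tendsto 0).mono_left nhdsWithin_le_nhds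
  have hr : Tendsto (fun ε => (4 * π * z ε) ^ (-(Module.finrank ℝ V : ℂ) / 2) *
      ∫ y, Complex.exp (-‖x - y‖ ^ 2 / (4 * z ε)) * f y) (𝓝[>] 0)
      (𝓝 ((4 * π * z 0) ^ (-(Module.finrank ℝ V : ℂ) / 2) *
        ∫ y, Complex.exp (-‖x - y‖ ^ 2 / (4 * z 0)) * f y)) := by
    refine Tendsto.mul ?_ ?_
    · refine Tendsto.mono_left ?_ nhdsWithin_le_nhds
      refine ContinuousAt.tendsto (f := fun ε => (4 * π * z ε) ^ (-(Module.finrank ℝ V : ℂ) / 2)) ?_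
      refine ContinuousAt.cpow (by fun_prop) (by fun_prop) ?_
      rw [Complex.mem_slitPlane_iff]
      right
      rw [hz0]
      simp [pi_ne_zero, ht]
    · refine tendsto_integral_filter_of_dominated_convergence (fun y => ‖f y‖) ?_ ?_
        f.integrable.norm ?_
      · exact .of_forall fun ε => Continuous.aestronglyMeasurable (by fun_prop)
      · filter_upwards [hpos] with ε hε
        refine .of_forall fun ξ => ?_
        rw [norm_mul]
        exact mul_le_of_le_one_left (norm_nonneg _)
          (norm_cexp_kernel_le _ (by rw [hzre]; exact hε.le) _ _)
      · refine .of_forall fun y => ?_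
        have hc : Continuous fun ε => Complex.exp (-‖x - y‖ ^ 2 / (4 * z ε)) * f y := by
          refine (Complex.continuous_exp.comp (Continuous.div (by fun_prop) (by fun_prop)
            fun ε => ?_)).mul continuous_const
          exact mul_ne_zero (by norm_num) (hzne ε)
        exact (hc.tendsto 0).mono_left nhdsWithin_le_nhds
  have heq := tendsto_nhds_unique (hr.congr' ?_) hl
  · rw [← heq, hz0, mul_assoc (4 * π : ℂ)]
    congr 2
    funext y
    congr 2
    have : (t : ℂ) ≠ 0 := by exact_mod_cast ht
    rw [div_eq_div_iff (by simpa using this) (by simpa using this)]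
    linear_combination (4 * t * ‖x - y‖ ^ 2 : ℂ) * Complex.I_sq
  · filter_upwards [hpos] with ε hε
    exact (integral_fourier_mul_gaussian f x (by rw [hzre]; exact hε)).symm

lemma norm_freeWave_le (F : 𝓢(V, ℂ)) (x : V) (t : ℝ) : ‖freeWave F x t‖ ≤ ∫ ξ, ‖F ξ‖ := by
  refine (norm_integral_le_integral_norm _).trans (le_of_eq ?_)
  congr 1 with ξ
  rw [norm_mul, show (-(4 * π ^ 2 * (Complex.I * t)) * ‖ξ‖ ^ 2 + 2 * π * Complex.I * ⟪x, ξ⟫ : ℂ) =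
    ((-(4 * π ^ 2 * t) * ‖ξ‖ ^ 2 + 2 * π * ⟪x, ξ⟫ : ℝ) : ℂ) * Complex.I by push_cast; ring,
    Complex.norm_exp_ofReal_mul_I, one_mul]

lemma norm_freeWave_le_of_ne_zero (f : 𝓢(V, ℂ)) (x : V) {t : ℝ} (ht : t ≠ 0) :
    ‖freeWave (𝓕 f) x t‖ ≤ |t| ^ (-(Module.finrank ℝ V : ℝ) / 2) * ∫ y, ‖f y‖ := by
  rw [← kernel_integral_eq_freeWave f x ht, norm_mul]
  have hne : (4 * π * Complex.I * (t : ℂ)) ≠ 0 := by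
    simp [pi_ne_zero, ht]
  refine mul_le_mul ?_ ?_ (norm_nonneg _) (by positivity)
  · rw [show (-(Module.finrank ℝ V : ℂ) / 2) = ((-(Module.finrank ℝ V : ℝ) / 2 : ℝ) : ℂ) by
      push_cast; rfl, Complex.norm_cpow_real]
    refine rpow_le_rpow_of_nonpos (abs_pos.2 ht) ?_ ?_
    · simp only [norm_mul, Complex.norm_I, Complex.norm_real, Real.norm_eq_abs,
        abs_of_pos pi_pos, mul_one]
      norm_num
      nlinarith [pi_gt_three, abs_nonneg t]
    · rw [neg_div, neg_nonpos]
      positivity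
  · refine (norm_integral_le_integral_norm _).trans (le_of_eq ?_)
    congr 1 with y
    rw [norm_mul, show (Complex.I * (‖x - y‖ : ℂ) ^ 2 / (4 * (t : ℂ))) =
      ((‖x - y‖ ^ 2 / (4 * t) : ℝ) : ℂ) * Complex.I by push_cast; ring,
      Complex.norm_exp_ofReal_mul_I, one_mul]

lemma continuous_freeWave (F : 𝓢(V, ℂ)) (x : V) :
    Continuous (freeWave F x) := by
  refine continuous_of_dominated (bound := fun ξ => ‖F ξ‖) (fun t => ?_) (fun t => ?_) F.integrable.norm ?_
  · exact Continuous.aestronglyMeasurable (by fun_prop)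
  · refine .of_forall fun ξ => ?_
    rw [norm_mul]
    exact mul_le_of_le_one_left (norm_nonneg _) (norm_cexp_gaussian_le _ (by simp) _ _)
  · exact .of_forall fun ξ => by fun_prop

lemma integrable_freeWave (hd : 3 ≤ Module.finrank ℝ V) (f : 𝓢(V, ℂ)) (x : V) :
    Integrable (freeWave (𝓕 f) x) := by
  set p : ℝ := Module.finrank ℝ V / 2 with hp
  have hp1 : 1 < p := by
    have : (3 : ℝ) ≤ Module.finrank ℝ V := by exact_mod_cast hd
    rw [hp]; linarith
  set A := ∫ ξ, ‖(𝓕 f : 𝓢(V, ℂ)) ξ‖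
  set B := ∫ y, ‖f y‖
  have hA : 0 ≤ A := integral_nonneg fun _ => norm_nonneg _
  have hB : 0 ≤ B := integral_nonneg fun _ => norm_nonneg _
  have hdom : Integrable fun t : ℝ => (A + B) * 2 ^ p * (1 + ‖t‖) ^ (-p) :=
    (integrable_one_add_norm (E := ℝ) (μ := volume) (r := p) (by simpa using hp1)).const_mul _
  refine hdom.mono' (continuous_freeWave (𝓕 f) x).aestronglyMeasurable
    (.of_forall fun t => ?_)
  have h1 : 0 < 1 + ‖t‖ := by positivity
  rw [rpow_neg h1.le, mul_assoc, ← div_eq_mul_inv, ← div_rpow (by norm_num) h1.le]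
  rcases le_total ‖t‖ 1 with ht | ht
  · have h2 : 1 ≤ (2 / (1 + ‖t‖)) ^ p :=
      one_le_rpow (by rw [le_div_iff₀ h1]; linarith) (by linarith)
    have h3 := norm_freeWave_le (𝓕 f) x t
    nlinarith
  · have ht0 : t ≠ 0 := by rintro rfl; simp at ht; linarith
    have h2 : |t| ^ (-p) ≤ (2 / (1 + ‖t‖)) ^ p := by
      rw [rpow_neg (abs_nonneg t), ← inv_rpow (abs_nonneg t)]
      have h4 : 0 < |t| := abs_pos.2 ht0
      rw [Real.norm_eq_abs] at ht h1 ⊢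
      refine rpow_le_rpow (by positivity) ?_ (by linarith)
      rw [le_div_iff₀ h1, inv_mul_le_iff₀ h4]
      linarith
    have h3 := norm_freeWave_le_of_ne_zero f x ht0
    rw [neg_div] at h3
    have h5 : 0 ≤ (2 / (1 + ‖t‖)) ^ p := by positivity
    calc _ ≤ |t| ^ (-p) * B := h3
      _ ≤ (2 / (1 + ‖t‖)) ^ p * (A + B) := by
          refine mul_le_mul h2 (by linarith) hB h5
      _ = _ := mul_comm _ _

end Propagator

section TimeFrequency

open Real

variable {V : Type*} [NormedAddCommGroup V] [InnerProductSpace ℝ V] [FiniteDimensional ℝ V]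
  [MeasurableSpace V] [BorelSpace V]

/-- The Fourier extension of the restriction of `F` to the sphere of radius `r`. -/
noncomputable def sphereExt (F : 𝓢(V, ℂ)) (r : ℝ) (x : V) : ℂ :=
  ∫ ω, Complex.exp (2 * π * Complex.I * ⟪x, r • (ω : V)⟫) * F (r • (ω : V)) ∂(surface V)

lemma continuous_sphereExt (F : 𝓢(V, ℂ)) :
    Continuous fun p : ℝ × V => sphereExt F p.1 p.2 := by
  have h := continuous_parametric_integral_of_continuous (μ := surface V)
    (f := fun (p : ℝ × V) (ω : Metric.sphere (0 : V) 1) =>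
      Complex.exp (2 * π * Complex.I * ⟪p.2, p.1 • (ω : V)⟫) * F (p.1 • (ω : V)))
    (by
      have := F.continuous
      simp only [Function.uncurry_def]
      fun_prop) isCompact_univ
  simpa only [Measure.restrict_univ, sphereExt] using h

lemma radial_integrable_and_freeWave_eq [Nontrivial V] (F : 𝓢(V, ℂ)) (x : V) (t : ℝ) :
    IntegrableOn (fun r : ℝ => (r ^ (Module.finrank ℝ V - 1) : ℝ) •
      (Complex.exp (-(4 * π ^ 2 * (Complex.I * t)) * r ^ 2) * sphereExt F r x)) (Set.Ioi 0) ∧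
    freeWave F x t = ∫ r in Set.Ioi (0 : ℝ), (r ^ (Module.finrank ℝ V - 1) : ℝ) •
      (Complex.exp (-(4 * π ^ 2 * (Complex.I * t)) * r ^ 2) * sphereExt F r x) := by
  set h : V → ℂ := fun ξ => Complex.exp (-(4 * π ^ 2 * (Complex.I * t)) * ‖ξ‖ ^ 2 +
    2 * π * Complex.I * ⟪x, ξ⟫) * F ξ with hh
  have hc : Continuous h := by fun_prop
  have hi : Integrable h := by
    refine F.integrable.mono hc.aestronglyMeasurable (.of_forall fun ξ => ?_)
    rw [norm_mul]
    exact mul_le_of_le_one_left (norm_nonneg _) (norm_cexp_gaussian_le _ (by simp) _ _)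
  have hmp := measurePreserving_polar (V := V)
  have hi' : Integrable (fun p : Metric.sphere (0 : V) 1 × ℝ => h (p.2 • (p.1 : V)))
      ((surface V).prod (radial (Module.finrank ℝ V))) :=
    (hmp.integrable_comp hc.aestronglyMeasurable).2 hi
  have hinner : ∀ r : ℝ, ∫ ω, h (r • (ω : V)) ∂(surface V) =
      Complex.exp (-(4 * π ^ 2 * (Complex.I * t)) * r ^ 2) * sphereExt F r x := by
    intro r
    rw [sphereExt, ← integral_const_mul]
    congr 1 with ω
    simp only [hh]
    rw [Complex.exp_add, mul_assoc]
    congr 3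
    rw [norm_smul, norm_eq_of_mem_sphere ω, mul_one, Real.norm_eq_abs, ← Complex.ofReal_pow,
      sq_abs, Complex.ofReal_pow]
  have hI := hi'.integral_prod_right
  simp only [hinner] at hI
  refine ⟨(integrable_radial_iff _).1 hI, ?_⟩
  have : freeWave F x t = ∫ p, h (p.2 • (p.1 : V))
      ∂((surface V).prod (radial (Module.finrank ℝ V))) := by
    rw [freeWave]
    change ∫ ξ, h ξ = _
    rw [← hmp.map_eq, integral_map hmp.measurable.aemeasurable hc.aestronglyMeasurable]
  rw [this, integral_prod_symm _ hi']
  simp only [hinner]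
  rw [integral_radial]

/-- The density in the time frequency `m` of the free evolution at `x`. -/
noncomputable def timeSpectrum (F : 𝓢(V, ℂ)) (x : V) (m : ℝ) : ℂ :=
  Set.indicator (Set.Ioi 0) (fun m => ((√(m / (2 * π)) ^ (Module.finrank ℝ V - 2) / (4 * π) : ℝ) : ℂ) *
    sphereExt F (√(m / (2 * π))) x) m

lemma timeSpectrum_of_nonpos (F : 𝓢(V, ℂ)) (x : V) {m : ℝ} (hm : m ≤ 0) :
    timeSpectrum F x m = 0 := by
  rw [timeSpectrum, Set.indicator_of_notMem (by simpa using hm)]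

lemma timeSpectrum_two_pi_mul_sq (F : 𝓢(V, ℂ)) (x : V) {r : ℝ} (hr : 0 < r) :
    timeSpectrum F x (2 * π * r ^ 2) =
      ((r ^ (Module.finrank ℝ V - 2) / (4 * π) : ℝ) : ℂ) * sphereExt F r x := by
  rw [timeSpectrum, Set.indicator_of_mem (by simp only [Set.mem_Ioi]; positivity),
    mul_div_cancel_left₀ _ (by positivity), sqrt_sq hr.le]

lemma continuousAt_timeSpectrum (F : 𝓢(V, ℂ)) (x : V) {m : ℝ} (hm : m ≠ 0) :
    ContinuousAt (timeSpectrum F x) m := by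
  rcases lt_or_gt_of_ne hm with h | h
  · refine (continuousAt_const (y := (0 : ℂ))).congr ?_
    filter_upwards [Iio_mem_nhds h] with y hy
    exact (timeSpectrum_of_nonpos F x (le_of_lt hy)).symm
  · have hc : Continuous fun m : ℝ =>
        ((√(m / (2 * π)) ^ (Module.finrank ℝ V - 2) / (4 * π) : ℝ) : ℂ) *
          sphereExt F (√(m / (2 * π))) x := by
      refine Continuous.mul (by fun_prop) ?_
      exact (continuous_sphereExt F).comp
        (Continuous.prodMk (by fun_prop : Continuous fun m : ℝ => √(m / (2 * π))) continuous_const)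
    refine hc.continuousAt.congr ?_
    filter_upwards [Ioi_mem_nhds h] with y hy
    rw [timeSpectrum, Set.indicator_of_mem hy]

lemma image_mul_sq_Ioi {c : ℝ} (hc : 0 < c) : (fun r : ℝ => c * r ^ 2) '' Set.Ioi 0 = Set.Ioi 0 := by
  ext y
  constructor
  · rintro ⟨r, hr, rfl⟩
    have : 0 < r := hr
    simp only [Set.mem_Ioi]
    positivity
  · intro hy
    have hy' : 0 < y := hy
    refine ⟨√(y / c), sqrt_pos.2 (by positivity), ?_⟩
    simp only
    rw [sq_sqrt (by positivity)]
    field_simp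

lemma hasDerivWithinAt_mul_sq (c r : ℝ) (s : Set ℝ) :
    HasDerivWithinAt (fun r : ℝ => c * r ^ 2) (2 * c * r) s r := by
  have := ((hasDerivAt_pow 2 r).const_mul c).hasDerivWithinAt (s := s)
  convert! this using 1
  push_cast
  ring

lemma injOn_mul_sq {c : ℝ} (hc : c ≠ 0) : Set.InjOn (fun r : ℝ => c * r ^ 2) (Set.Ioi 0) := by
  intro a ha b hb hab
  have : a ^ 2 = b ^ 2 := mul_left_cancel₀ hc hab
  exact (pow_left_inj₀ (le_of_lt ha) (le_of_lt hb) two_ne_zero).1 this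

lemma integrable_timeSpectrum_and_fourier (hd : 3 ≤ Module.finrank ℝ V) (F : 𝓢(V, ℂ)) (x : V) :
    Integrable (timeSpectrum F x) ∧ 𝓕 (timeSpectrum F x) = freeWave F x := by
  have : Nontrivial V := Module.nontrivial_of_finrank_pos (R := ℝ) (by omega)
  have hpi : (0 : ℝ) < 2 * π := by positivity
  have hkey : ∀ t : ℝ, ∀ r ∈ Set.Ioi (0 : ℝ),
      |2 * (2 * π) * r| • (Complex.exp (((-2 * π * (2 * π * r ^ 2) * t : ℝ) : ℂ) * Complex.I) •
        timeSpectrum F x (2 * π * r ^ 2)) =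
      (r ^ (Module.finrank ℝ V - 1) : ℝ) •
        (Complex.exp (-(4 * π ^ 2 * (Complex.I * t)) * r ^ 2) * sphereExt F r x) := by
    intro t r hr
    have hr' : 0 < r := hr
    rw [timeSpectrum_two_pi_mul_sq F x hr', abs_of_pos (by positivity),
      show Module.finrank ℝ V - 1 = (Module.finrank ℝ V - 2) + 1 by omega,
      pow_succ r (Module.finrank ℝ V - 2),
      show (((-2 * π * (2 * π * r ^ 2) * t : ℝ) : ℂ) * Complex.I) =
        -(4 * π ^ 2 * (Complex.I * t)) * r ^ 2 by push_cast; ring]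
    simp only [Complex.real_smul, smul_eq_mul]
    have : (π : ℂ) ≠ 0 := by exact_mod_cast pi_ne_zero
    push_cast
    field_simp
    ring
  have hi : Integrable (timeSpectrum F x) := by
    have h0 := (radial_integrable_and_freeWave_eq F x 0).1
    have h1 : IntegrableOn (timeSpectrum F x) (Set.Ioi 0) := by
      rw [← image_mul_sq_Ioi hpi, integrableOn_image_iff_integrableOn_abs_deriv_smul
        measurableSet_Ioi (fun r _ => hasDerivWithinAt_mul_sq _ r _) (injOn_mul_sq hpi.ne')]
      refine h0.congr_fun (fun r hr => ?_) measurableSet_Ioi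
      have := hkey 0 r hr
      simp only [mul_zero, Complex.ofReal_zero, zero_mul, Complex.exp_zero, one_smul] at this
      rw [this]
      simp
    refine (integrableOn_iff_integrable_of_support_subset fun m hm => ?_).1 h1
    by_contra hm'
    exact hm (timeSpectrum_of_nonpos F x (by simpa using hm'))
  refine ⟨hi, ?_⟩
  ext t
  rw [(radial_integrable_and_freeWave_eq F x t).2, Real.fourier_real_eq_integral_exp_smul,
    ← setIntegral_eq_integral_of_forall_compl_eq_zero (s := Set.Ioi 0) fun m hm => by
      rw [timeSpectrum_of_nonpos F x (by simpa using hm), smul_zero],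
    ← image_mul_sq_Ioi hpi, integral_image_eq_integral_abs_deriv_smul
        measurableSet_Ioi (fun r _ => hasDerivWithinAt_mul_sq _ r _) (injOn_mul_sq hpi.ne'),
    image_mul_sq_Ioi hpi]
  exact setIntegral_congr_fun measurableSet_Ioi fun r hr => hkey t r hr

lemma integral_exp_mul_freeWave (hd : 3 ≤ Module.finrank ℝ V) (f : 𝓢(V, ℂ)) (x : V) {lam : ℝ}
    (hlam : lam ≠ 0) :
    ∫ t : ℝ, Complex.exp (-(Complex.I * (t : ℂ) * (lam : ℂ))) * freeWave (𝓕 f) x t =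
      timeSpectrum (𝓕 f) x (-lam / (2 * π)) := by
  obtain ⟨hi, hF⟩ := integrable_timeSpectrum_and_fourier hd (𝓕 f) x
  have h := hi.fourierInv_fourier_eq (by rw [hF]; exact integrable_freeWave hd f x)
    (continuousAt_timeSpectrum (𝓕 f) x
      (m := -lam / (2 * π)) (div_ne_zero (neg_ne_zero.2 hlam) (by positivity)))
  rw [← h, hF, Real.fourierInv_eq']
  congr 1 with t
  rw [smul_eq_mul]
  congr 2
  rw [show ⟪t, -lam / (2 * π)⟫ = -lam / (2 * π) * t from rfl]
  have : (π : ℂ) ≠ 0 := by exact_mod_cast pi_ne_zero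
  push_cast
  field_simp

end TimeFrequency

section Smoothing

open Real

variable {V : Type*} [NormedAddCommGroup V] [InnerProductSpace ℝ V] [FiniteDimensional ℝ V]
  [MeasurableSpace V] [BorelSpace V]

lemma eLpNorm_two_sq {X E : Type*} [MeasurableSpace X] [NormedAddCommGroup E] (μ : Measure X)
    (g : X → E) : eLpNorm g 2 μ ^ 2 = ∫⁻ x, ‖g x‖ₑ ^ 2 ∂μ := by
  have := eLpNorm_nnreal_pow_eq_lintegral (f := g) (μ := μ) (p := 2) two_ne_zero
  simpa using this

lemma lintegral_enorm_sq_fourier (f : 𝓢(V, ℂ)) :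
    ∫⁻ ξ, ‖𝓕 f ξ‖ₑ ^ 2 = eLpNorm f 2 volume ^ 2 := by
  rw [← eLpNorm_two_sq]
  congr 1
  have h := norm_fourier_toL2_eq f
  rw [norm_toLp, norm_toLp] at h
  exact (ENNReal.toReal_eq_toReal_iff' ((𝓕 f).eLpNorm_lt_top 2 volume).ne
    (f.eLpNorm_lt_top 2 volume).ne).1 h

/-- The density in the radial frequency of the squared `H^{1/4}` norm in time of the free
evolution at a point, without the spherical factor. -/
noncomputable def radialDensity (d : ℕ) (r : ℝ) : ℝ :=
  8 * π ^ 2 * r * ((1 + (-(4 * π ^ 2) * r ^ 2) ^ 2) ^ ((1 : ℝ) / 4) *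
    (r ^ (d - 2) / (4 * π)) ^ 2)

lemma lintegral_weight_mul_timeSpectrum (F : 𝓢(V, ℂ)) (x : V) :
    ∫⁻ lam : ℝ, ENNReal.ofReal ((1 + lam ^ 2) ^ ((1 : ℝ) / 4)) *
      ‖timeSpectrum F x (-lam / (2 * π))‖ₑ ^ 2 =
    ∫⁻ r in Set.Ioi (0 : ℝ), ENNReal.ofReal (radialDensity (Module.finrank ℝ V) r) *
      ‖sphereExt F r x‖ₑ ^ 2 := by
  have hpi : (0 : ℝ) < 4 * π ^ 2 := by positivity
  have himg : (fun r : ℝ => -(4 * π ^ 2) * r ^ 2) '' Set.Ioi 0 = Set.Iio 0 := by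
    have : (fun r : ℝ => -(4 * π ^ 2) * r ^ 2) = Neg.neg ∘ fun r : ℝ => 4 * π ^ 2 * r ^ 2 := by
      ext r
      simp
    rw [this, Set.image_comp, image_mul_sq_Ioi hpi, Set.image_neg_eq_neg, Set.neg_Ioi, neg_zero]
  rw [← setLIntegral_eq_of_support_subset (s := Set.Iio 0), ← himg,
    lintegral_image_eq_lintegral_abs_deriv_mul measurableSet_Ioi
      (fun r _ => hasDerivWithinAt_mul_sq _ r _) (injOn_mul_sq (neg_ne_zero.2 hpi.ne'))]
  · refine setLIntegral_congr_fun measurableSet_Ioi fun r hr => ?_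
    have hr' : 0 < r := hr
    have harg : -(-(4 * π ^ 2) * r ^ 2) / (2 * π) = 2 * π * r ^ 2 := by
      field_simp
      ring
    have habs : |2 * -(4 * π ^ 2) * r| = 8 * π ^ 2 * r := by
      rw [show 2 * -(4 * π ^ 2) * r = -(8 * π ^ 2 * r) by ring, abs_neg, abs_of_pos (by positivity)]
    simp only [radialDensity]
    rw [harg, timeSpectrum_two_pi_mul_sq F x hr', habs, enorm_mul, mul_pow,
      ENNReal.ofReal_mul (p := 8 * π ^ 2 * r) (by positivity),
      ENNReal.ofReal_mul (p := _ ^ ((1 : ℝ) / 4)) (by positivity),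
      ENNReal.ofReal_pow (by positivity), ← ofReal_norm (Complex.ofReal _), Complex.norm_real,
      Real.norm_of_nonneg (by positivity)]
    ring
  · intro lam hlam
    by_contra h
    refine hlam ?_
    have : -lam / (2 * π) ≤ 0 :=
      div_nonpos_of_nonpos_of_nonneg (neg_nonpos.2 (by simpa using h)) (by positivity)
    simp [timeSpectrum_of_nonpos F x this]

lemma one_add_sq_rpow_quarter_le {r : ℝ} (hr : 0 ≤ r) :
    (1 + (-(4 * π ^ 2) * r ^ 2) ^ 2) ^ ((1 : ℝ) / 4) ≤ 2 * π * (1 + r) := by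
  have hp : 1 ≤ 2 * π := by linarith [pi_gt_three]
  have h : 1 + (-(4 * π ^ 2) * r ^ 2) ^ 2 ≤ (2 * π * (1 + r)) ^ (4 : ℕ) := by
    have h1 : (1 : ℝ) ≤ (2 * π) ^ 4 := one_le_pow₀ hp
    have h2 : 1 + r ^ 4 ≤ (1 + r) ^ 4 := by
      have : 0 ≤ 4 * r + 6 * r ^ 2 + 4 * r ^ 3 := by positivity
      nlinarith
    calc 1 + (-(4 * π ^ 2) * r ^ 2) ^ 2 = 1 + (2 * π) ^ 4 * r ^ 4 := by ring
      _ ≤ (2 * π) ^ 4 * (1 + r ^ 4) := by linarith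
      _ ≤ (2 * π) ^ 4 * (1 + r) ^ 4 := by gcongr
      _ = (2 * π * (1 + r)) ^ (4 : ℕ) := by ring
  refine (rpow_le_rpow (by positivity) h (by norm_num)).trans (le_of_eq ?_)
  rw [← Real.rpow_natCast, ← rpow_mul (by positivity)]
  norm_num

lemma radialDensity_mul_le {d : ℕ} (hd : 3 ≤ d) {C : ℝ} (hC : 0 ≤ C) {r : ℝ} (hr : 0 < r) :
    radialDensity d r * (C * (r ^ 2 / r ^ d) / (1 + r)) ≤ π * C * r ^ (d - 1) := by
  have h := one_add_sq_rpow_quarter_le hr.le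
  obtain ⟨k, rfl⟩ : ∃ k, d = k + 2 := ⟨d - 2, by omega⟩
  rw [show k + 2 - 1 = k + 1 by omega, radialDensity, show k + 2 - 2 = k by omega]
  calc _ ≤ 8 * π ^ 2 * r * (2 * π * (1 + r) * (r ^ k / (4 * π)) ^ 2) *
        (C * (r ^ 2 / r ^ (k + 2)) / (1 + r)) := by gcongr
    _ = π * C * r ^ (k + 1) := by
      field_simp
      ring

lemma exists_smoothing_constant (hd : 3 ≤ Module.finrank ℝ V) :
    ∃ C : ℝ, ∀ f : 𝓢(V, ℂ),
      ∫⁻ x : V, ENNReal.ofReal ((1 + ‖x‖ ^ 2)⁻¹) *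
        ∫⁻ lam : ℝ, ENNReal.ofReal ((1 + lam ^ 2) ^ ((1 : ℝ) / 4)) *
          ‖∫ t : ℝ, Complex.exp (-(Complex.I * (t : ℂ) * (lam : ℂ))) * freeWave (𝓕 f) x t‖ₑ ^ 2
      ≤ ENNReal.ofReal C * eLpNorm f 2 volume ^ 2 := by
  have : Nontrivial V := Module.nontrivial_of_finrank_pos (R := ℝ) (by omega)
  obtain ⟨C, hC, hbound⟩ := exists_lintegral_weight_mul_extension_le (V := V) hd
  refine ⟨π * C, fun f => ?_⟩
  set F : 𝓢(V, ℂ) := 𝓕 f with hF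
  have hmeas : Measurable fun p : V × ℝ => sphereExt F p.2 p.1 :=
    ((continuous_sphereExt F).comp continuous_swap).measurable
  have hdens : Measurable (radialDensity (Module.finrank ℝ V)) := by
    unfold radialDensity
    fun_prop
  have htime : ∀ x : V, ∫⁻ lam : ℝ, ENNReal.ofReal ((1 + lam ^ 2) ^ ((1 : ℝ) / 4)) *
        ‖∫ t : ℝ, Complex.exp (-(Complex.I * (t : ℂ) * (lam : ℂ))) * freeWave F x t‖ₑ ^ 2 =
      ∫⁻ r in Set.Ioi (0 : ℝ), ENNReal.ofReal (radialDensity (Module.finrank ℝ V) r) *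
        ‖sphereExt F r x‖ₑ ^ 2 := by
    intro x
    rw [← lintegral_weight_mul_timeSpectrum]
    refine lintegral_congr_ae ?_
    filter_upwards [Measure.ae_ne volume (0 : ℝ)] with lam hlam
    rw [integral_exp_mul_freeWave hd f x hlam]
  simp_rw [htime]
  calc ∫⁻ x : V, ENNReal.ofReal ((1 + ‖x‖ ^ 2)⁻¹) * ∫⁻ r in Set.Ioi (0 : ℝ),
        ENNReal.ofReal (radialDensity (Module.finrank ℝ V) r) * ‖sphereExt F r x‖ₑ ^ 2
      = ∫⁻ x : V, ∫⁻ r in Set.Ioi (0 : ℝ), ENNReal.ofReal ((1 + ‖x‖ ^ 2)⁻¹) *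
        (ENNReal.ofReal (radialDensity (Module.finrank ℝ V) r) * ‖sphereExt F r x‖ₑ ^ 2) := by
        congr 1 with x
        rw [lintegral_const_mul]
        have : Measurable fun r : ℝ => sphereExt F r x :=
          hmeas.comp (measurable_const.prodMk measurable_id)
        fun_prop
    _ = ∫⁻ r in Set.Ioi (0 : ℝ), ∫⁻ x : V, ENNReal.ofReal ((1 + ‖x‖ ^ 2)⁻¹) *
        (ENNReal.ofReal (radialDensity (Module.finrank ℝ V) r) * ‖sphereExt F r x‖ₑ ^ 2) := by
        refine lintegral_lintegral_swap (Measurable.aemeasurable ?_)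
        simp only [Function.uncurry_def]
        fun_prop
    _ = ∫⁻ r in Set.Ioi (0 : ℝ), ENNReal.ofReal (radialDensity (Module.finrank ℝ V) r) *
        ∫⁻ x : V, ENNReal.ofReal ((1 + ‖x‖ ^ 2)⁻¹) * ‖sphereExt F r x‖ₑ ^ 2 := by
        congr 1 with r
        have : Measurable fun x : V => sphereExt F r x :=
          hmeas.comp (measurable_id.prodMk measurable_const)
        rw [← lintegral_const_mul _ (by fun_prop)]
        congr 1 with x
        ring
    _ ≤ ∫⁻ r in Set.Ioi (0 : ℝ), ENNReal.ofReal (π * C) *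
        (ENNReal.ofReal (r ^ (Module.finrank ℝ V - 1)) *
          ∫⁻ ω, ‖F (r • (ω : V))‖ₑ ^ 2 ∂(surface V)) := by
        refine setLIntegral_mono' measurableSet_Ioi fun r hr => ?_
        have hr' : 0 < r := hr
        have hFc := F.continuous
        obtain ⟨M, hM⟩ := F.decay 0 0
        have hb := hbound r hr' (fun ω => F (r • (ω : V))) M
          (Continuous.measurable (by fun_prop)) fun ω => by simpa using hM.2 (r • (ω : V))
        have hdens0 : 0 ≤ radialDensity (Module.finrank ℝ V) r := by
          unfold radialDensity
          positivity
        calc _ ≤ ENNReal.ofReal (radialDensity (Module.finrank ℝ V) r) *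
              (ENNReal.ofReal (C * (r ^ 2 / r ^ Module.finrank ℝ V) / (1 + r)) *
                ∫⁻ ω, ‖F (r • (ω : V))‖ₑ ^ 2 ∂(surface V)) := by
              gcongr
              exact hb
          _ ≤ _ := by
              rw [← mul_assoc, ← mul_assoc, ← ENNReal.ofReal_mul hdens0,
                ← ENNReal.ofReal_mul (by positivity)]
              exact mul_le_mul_left (ENNReal.ofReal_le_ofReal (radialDensity_mul_le hd hC hr')) _
    _ = ENNReal.ofReal (π * C) * eLpNorm f 2 volume ^ 2 := by
        have hFc := F.continuous
        rw [lintegral_const_mul' _ _ ENNReal.ofReal_ne_top, ← lintegral_enorm_sq_fourier,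
          lintegral_polar (F := fun ξ => ‖F ξ‖ₑ ^ 2) (Continuous.measurable (by fun_prop))]

end Smoothing

end FreeSmoothing

/-- Local smoothing for the free evolution: a quarter time-derivative gain,
`∫ ⟨x⟩⁻² ‖e^{itΔ}f(x)‖²_{H^{1/4}_t(ℝ)} dx ≲ ‖f‖²_{L²}` for `n ≥ 3`. -/
theorem free_smoothing_quarter_derivative (n : ℕ) (hn : 3 ≤ n) :
    ∃ C : ℝ≥0∞, C ≠ ⊤ ∧
      ∀ f : 𝓢(EuclideanSpace ℝ (Fin n), ℂ),
        (∫⁻ x : EuclideanSpace ℝ (Fin n),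
            ENNReal.ofReal ((1 + ‖x‖ ^ 2)⁻¹) *
              HnormSq ((1 : ℝ) / 4) (fun t => schrod n t (⇑f) x))
          ≤ C * (eLpNorm (⇑f) 2 volume) ^ 2 := by
  obtain ⟨C, hC⟩ := FreeSmoothing.exists_smoothing_constant (V := EuclideanSpace ℝ (Fin n))
    (by rwa [finrank_euclideanSpace_fin])
  refine ⟨ENNReal.ofReal C, ENNReal.ofReal_ne_top, fun f => le_trans (le_of_eq ?_) (hC f)⟩
  refine lintegral_congr fun x => ?_
  rw [HnormSq]
  congr 1
  refine lintegral_congr fun lam => ?_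
  rw [← enorm_eq_nnnorm]
  congr 3
  refine integral_congr_ae ?_
  filter_upwards [Measure.ae_ne volume (0 : ℝ)] with t ht
  rw [schrod, if_neg ht, ← FreeSmoothing.kernel_integral_eq_freeWave f x ht,
    finrank_euclideanSpace_fin]
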